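/- arXiv:0904.3957 — 3 statements merged into one kernel-verified Lean document; each statement's English description precedes it below -/
import Mathlib

section
/- The map ξ defined by ξ([I:J]) = [j_1,…,j_h, m+u_1,…,m+u_{n−h}] (where u_1 < … < u_{n−h} are determined by {n+1−u_1,…,n+1−u_{n−h}} = {1,…,n} \ I) is an order isomorphism from the poset (D(n,m), ⪯) onto the subposet of L(n,m+n) consisting of all elements of length n except [m+1,…,m+n]. -/
noncomputable section

/-- One-line tableau predicate: `isTab n m I J` says `[I:J]` is a one-line tableau in `D(n,m)`,
i.e. `I ⊆ {1,…,n}` and `J ⊆ {1,…,m}` are strictly increasing sequences of the same (positive) length. -/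
def isTab (n m : ℕ) (I J : List ℕ) : Prop :=
  I.length = J.length ∧ I ≠ [] ∧ I.Chain' (· < ·) ∧ J.Chain' (· < ·) ∧
    (∀ x ∈ I, 1 ≤ x ∧ x ≤ n) ∧ ∀ x ∈ J, 1 ≤ x ∧ x ≤ m

/-- The tableau order `A ⪯ B` on one-line tableaux. -/
def tleq (A B : List ℕ × List ℕ) : Prop :=
  B.1.length ≤ A.1.length ∧
    ∀ r < B.1.length, A.1.getD r 0 ≤ B.1.getD r 0 ∧ A.2.getD r 0 ≤ B.2.getD r 0

/-- The map ξ : `ξ([I:J]) = [j₁,…,jₕ, m+u₁,…,m+u_{n−h}]` where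
`{n+1−u₁,…,n+1−u_{n−h}}` is the complement of `I` in `{1,…,n}`. -/
def xi (n m : ℕ) (I J : List ℕ) : List ℕ :=
  J ++ ((((List.range n).map (· + 1)).filter fun c => decide (c ∉ I)).reverse.map
      fun c => m + (n + 1 - c))

/-- The top element `[m+1, …, m+n]`. -/
def topL (n m : ℕ) : List ℕ := (List.range n).map fun r => m + r + 1

/-- The entries of a strictly increasing list that are at most `t` form an initial segment. -/
lemma getD_le_iff_lt_countP {A : List ℕ} (hA : A.Pairwise (· < ·)) (t : ℕ) {r : ℕ}
    (hr : r < A.length) : A.getD r 0 ≤ t ↔ r < A.countP (· ≤ t) := by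
  induction A generalizing r with
  | nil => simp at hr
  | cons a l ih =>
    obtain ⟨ha, hl⟩ := List.pairwise_cons.1 hA
    rw [List.countP_cons]
    by_cases hat : a ≤ t
    · cases r with
      | zero => simp [hat]
      | succ r => simpa [hat] using ih hl (by simpa using hr)
    · have h0 : l.countP (· ≤ t) = 0 := by
        rw [List.countP_eq_zero]
        intro x hx
        have := ha x hx
        simp only [decide_eq_true_eq]
        omega
      rw [h0]
      cases r with
      | zero => simp [hat]
      | succ r =>
        have hr' : r < l.length := by simpa using hr
        have := ha _ (List.getElem_mem hr')
        simp only [List.getD_cons_succ, List.getD_eq_getElem _ _ hr', hat]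
        simp
        omega

/-- Entrywise comparison of strictly increasing lists, in terms of counting functions. -/
lemma entrywise_le_iff_countP_le {A B : List ℕ} (hA : A.Pairwise (· < ·))
    (hB : B.Pairwise (· < ·)) :
    (B.length ≤ A.length ∧ ∀ r < B.length, A.getD r 0 ≤ B.getD r 0) ↔
      ∀ t, B.countP (· ≤ t) ≤ A.countP (· ≤ t) := by
  constructor
  · rintro ⟨hlen, h⟩ t
    by_contra! hlt
    have hr : A.countP (· ≤ t) < B.length := hlt.trans_le List.countP_le_length
    have hBt := (getD_le_iff_lt_countP hB t hr).2 hlt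
    have := (getD_le_iff_lt_countP hA t (hr.trans_le hlen)).1 ((h _ hr).trans hBt)
    omega
  · intro h
    have key : ∀ r < B.length, r < A.countP (· ≤ B.getD r 0) := fun r hr =>
      ((getD_le_iff_lt_countP hB _ hr).1 le_rfl).trans_le (h _)
    have hlen : B.length ≤ A.length := by
      by_contra! hlt
      exact absurd (key _ hlt) (not_lt.2 List.countP_le_length)
    exact ⟨hlen, fun r hr => (getD_le_iff_lt_countP hA _ (hr.trans_le hlen)).2 (key r hr)⟩

lemma countP_le_map_range (n k : ℕ) :
    ((List.range n).map (· + 1)).countP (· ≤ k) = min n k := by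
  induction n with
  | zero => simp
  | succ n ih =>
    rw [List.range_succ, List.map_append, List.countP_append, ih]
    by_cases h : n + 1 ≤ k
    · simp [h]; omega
    · simp [h]; omega

/-- The complement of `I` in `[1, …, n]`, listed increasingly. -/
def complList (n : ℕ) (I : List ℕ) : List ℕ :=
  ((List.range n).map (· + 1)).filter fun c => decide (c ∉ I)

lemma mem_complList {n : ℕ} {I : List ℕ} {c : ℕ} : c ∈ complList n I ↔ (1 ≤ c ∧ c ≤ n) ∧ c ∉ I := by
  simp only [complList, List.mem_filter, List.mem_map, List.mem_range, decide_eq_true_eq]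
  refine and_congr_left fun _ => ⟨?_, fun h => ⟨c - 1, by omega, by omega⟩⟩
  rintro ⟨a, h, rfl⟩
  omega

lemma pairwise_map_range (n : ℕ) : ((List.range n).map (· + 1)).Pairwise (· < ·) := by
  rw [List.pairwise_map]
  exact List.pairwise_lt_range.imp (by omega)

lemma pairwise_complList (n : ℕ) (I : List ℕ) : (complList n I).Pairwise (· < ·) :=
  (pairwise_map_range n).filter _

lemma nodup_of_pairwise_lt {L : List ℕ} (h : L.Pairwise (· < ·)) : L.Nodup :=
  h.imp fun h => h.ne

lemma append_complList_perm {n : ℕ} {I : List ℕ} (hI : I.Pairwise (· < ·))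
    (hIn : ∀ x ∈ I, 1 ≤ x ∧ x ≤ n) : (I ++ complList n I).Perm ((List.range n).map (· + 1)) := by
  rw [List.perm_ext_iff_of_nodup]
  · intro a
    have : a ∈ (List.range n).map (· + 1) ↔ 1 ≤ a ∧ a ≤ n := by
      simpa [complList] using mem_complList (n := n) (I := []) (c := a)
    rw [this, List.mem_append, mem_complList]
    have := hIn a
    tauto
  · refine (nodup_of_pairwise_lt hI).append (nodup_of_pairwise_lt (pairwise_complList n I)) ?_
    intro a ha ha'
    exact (mem_complList.1 ha').2 ha
  · exact nodup_of_pairwise_lt (pairwise_map_range n)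

lemma xi_eq (n m : ℕ) (I J : List ℕ) :
    xi n m I J = J ++ (complList n I).reverse.map fun c => m + (n + 1 - c) := rfl

lemma mem_xi {n m : ℕ} {I J : List ℕ} {x : ℕ} :
    x ∈ xi n m I J ↔ x ∈ J ∨ ∃ c, ((1 ≤ c ∧ c ≤ n) ∧ c ∉ I) ∧ m + (n + 1 - c) = x := by
  simp [xi_eq, mem_complList]

lemma length_add_length_complList {n : ℕ} {I : List ℕ} (hI : I.Pairwise (· < ·))
    (hIn : ∀ x ∈ I, 1 ≤ x ∧ x ≤ n) : I.length + (complList n I).length = n := by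
  simpa using (append_complList_perm hI hIn).length_eq

lemma length_xi (n m : ℕ) (I J : List ℕ) :
    (xi n m I J).length = J.length + (complList n I).length := by
  simp [xi_eq]

lemma pairwise_xi {n m : ℕ} {J : List ℕ} (I : List ℕ) (hJ : J.Pairwise (· < ·))
    (hJm : ∀ x ∈ J, x ≤ m) : (xi n m I J).Pairwise (· < ·) := by
  rw [xi_eq, List.pairwise_append]
  refine ⟨hJ, ?_, ?_⟩
  · rw [List.pairwise_map, List.pairwise_reverse]
    refine (pairwise_complList n I).imp_of_mem fun ha hb hab => ?_
    have := mem_complList.1 ha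
    have := mem_complList.1 hb
    omega
  · intro a ha b hb
    simp only [List.mem_map, List.mem_reverse, mem_complList] at hb
    obtain ⟨c, hc, rfl⟩ := hb
    have := hJm a ha
    omega

lemma countP_xi_of_le {n m t : ℕ} (I J : List ℕ) (ht : t ≤ m) :
    (xi n m I J).countP (· ≤ t) = J.countP (· ≤ t) := by
  rw [xi_eq, List.countP_append, Nat.add_eq_left, List.countP_eq_zero]
  intro x hx
  simp only [List.mem_map, List.mem_reverse, mem_complList] at hx
  obtain ⟨c, hc, rfl⟩ := hx
  simp only [decide_eq_true_eq]
  omega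

lemma countP_xi_add {n m s : ℕ} {I J : List ℕ} (h : isTab n m I J) (hs : s ≤ n) :
    (xi n m I J).countP (· ≤ m + s) = s + I.countP (· ≤ n - s) := by
  obtain ⟨hlen, -, hI, -, hIn, hJm⟩ := h
  replace hI := List.isChain_iff_pairwise.1 hI
  have hJ : J.countP (· ≤ m + s) = J.length := by
    rw [List.countP_eq_length]
    intro x hx
    have := hJm x hx
    simp only [decide_eq_true_eq]
    omega
  have hF : (complList n I).countP (fun c => decide (m + (n + 1 - c) ≤ m + s)) =
      (complList n I).countP (fun c => decide ¬ (decide (c ≤ n - s) = true)) := by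
    refine List.countP_congr fun c hc => ?_
    have := mem_complList.1 hc
    simp only [decide_eq_true_eq]
    omega
  have h1 := List.length_eq_countP_add_countP (fun c => decide (c ≤ n - s)) (l := complList n I)
  have h2 := (append_complList_perm hI hIn).countP_eq (fun c => decide (c ≤ n - s))
  rw [List.countP_append, countP_le_map_range] at h2
  have h3 := length_add_length_complList hI hIn
  have h4 : (xi n m I J).countP (· ≤ m + s) = J.length +
      (complList n I).countP (fun c => decide ¬ (decide (c ≤ n - s) = true)) := by
    rw [← hF, ← hJ, xi_eq, List.countP_append, List.countP_map, List.countP_reverse]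
    rfl
  omega

lemma countP_eq_of_bound_le {L : List ℕ} {N t : ℕ} (hL : ∀ x ∈ L, x ≤ N) (ht : N ≤ t) :
    L.countP (· ≤ t) = L.countP (· ≤ N) := by
  refine List.countP_congr fun x hx => ?_
  have := hL x hx
  simp only [decide_eq_true_eq]
  omega

/-- The counting functions of `xi` compare exactly as those of both rows do. -/
lemma countP_xi_le_iff {n m : ℕ} {I J I' J' : List ℕ} (h : isTab n m I J)
    (h' : isTab n m I' J') :
    (∀ t, (xi n m I' J').countP (· ≤ t) ≤ (xi n m I J).countP (· ≤ t)) ↔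
      (∀ t, I'.countP (· ≤ t) ≤ I.countP (· ≤ t)) ∧
        ∀ t, J'.countP (· ≤ t) ≤ J.countP (· ≤ t) := by
  have bI : ∀ x ∈ I, x ≤ n := fun x hx => (h.2.2.2.2.1 x hx).2
  have bI' : ∀ x ∈ I', x ≤ n := fun x hx => (h'.2.2.2.2.1 x hx).2
  have bJ : ∀ x ∈ J, x ≤ m := fun x hx => (h.2.2.2.2.2 x hx).2
  have bJ' : ∀ x ∈ J', x ≤ m := fun x hx => (h'.2.2.2.2.2 x hx).2
  constructor
  · intro H
    have HI : ∀ t ≤ n, I'.countP (· ≤ t) ≤ I.countP (· ≤ t) := fun t ht => by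
      have := H (m + (n - t))
      rw [countP_xi_add h (by omega), countP_xi_add h' (by omega), Nat.sub_sub_self ht] at this
      omega
    have HJ : ∀ t ≤ m, J'.countP (· ≤ t) ≤ J.countP (· ≤ t) := fun t ht => by
      simpa only [countP_xi_of_le _ _ ht] using H t
    constructor
    · intro t
      rcases le_total t n with ht | ht
      · exact HI t ht
      · rw [countP_eq_of_bound_le bI ht, countP_eq_of_bound_le bI' ht]
        exact HI n le_rfl
    · intro t
      rcases le_total t m with ht | ht
      · exact HJ t ht
      · rw [countP_eq_of_bound_le bJ ht, countP_eq_of_bound_le bJ' ht]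
        exact HJ m le_rfl
  · rintro ⟨HI, HJ⟩ t
    have key : ∀ s ≤ n,
        (xi n m I' J').countP (· ≤ m + s) ≤ (xi n m I J).countP (· ≤ m + s) := fun s hs => by
      rw [countP_xi_add h hs, countP_xi_add h' hs]
      exact Nat.add_le_add_left (HI _) s
    rcases le_total t m with ht | ht
    · rw [countP_xi_of_le _ _ ht, countP_xi_of_le _ _ ht]
      exact HJ t
    · rcases le_total t (m + n) with ht' | ht'
      · obtain ⟨s, rfl⟩ := Nat.exists_eq_add_of_le ht
        exact key s (by omega)
      · have bxi : ∀ {I J : List ℕ}, (∀ x ∈ J, x ≤ m) → ∀ x ∈ xi n m I J, x ≤ m + n := by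
          intro I J hJ x hx
          rcases mem_xi.1 hx with hx | ⟨c, hc, rfl⟩
          · exact (hJ x hx).trans (Nat.le_add_right m n)
          · omega
        rw [countP_eq_of_bound_le (bxi bJ) ht', countP_eq_of_bound_le (bxi bJ') ht']
        exact key n le_rfl

lemma isTab.pairwise_xi {n m : ℕ} {I J : List ℕ} (h : isTab n m I J) :
    (xi n m I J).Pairwise (· < ·) :=
  _root_.pairwise_xi I (List.isChain_iff_pairwise.1 h.2.2.2.1) fun x hx => (h.2.2.2.2.2 x hx).2

lemma isTab.length_xi {n m : ℕ} {I J : List ℕ} (h : isTab n m I J) :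
    (xi n m I J).length = n := by
  rw [_root_.length_xi, ← h.1]
  exact length_add_length_complList (List.isChain_iff_pairwise.1 h.2.2.1) h.2.2.2.2.1

lemma tleq_iff_xi_le {n m : ℕ} {A B : List ℕ × List ℕ} (hA : isTab n m A.1 A.2)
    (hB : isTab n m B.1 B.2) :
    tleq A B ↔ ∀ r < n, (xi n m A.1 A.2).getD r 0 ≤ (xi n m B.1 B.2).getD r 0 := by
  have e := entrywise_le_iff_countP_le hA.pairwise_xi hB.pairwise_xi
  rw [hA.length_xi, hB.length_xi, countP_xi_le_iff hA hB] at e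
  have hA' := hA
  have hB' := hB
  obtain ⟨lA, -, hA1, hA2, -⟩ := hA'
  obtain ⟨lB, -, hB1, hB2, -⟩ := hB'
  have e1 := entrywise_le_iff_countP_le (List.isChain_iff_pairwise.1 hA1)
    (List.isChain_iff_pairwise.1 hB1)
  have e2 := entrywise_le_iff_countP_le (List.isChain_iff_pairwise.1 hA2)
    (List.isChain_iff_pairwise.1 hB2)
  rw [← e1, ← e2, ← lA, ← lB] at e
  refine Iff.trans ⟨?_, ?_⟩ (e.symm.trans (and_iff_right le_rfl))
  · exact fun ⟨hl, h⟩ => ⟨⟨hl, fun r hr => (h r hr).1⟩, hl, fun r hr => (h r hr).2⟩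
  · exact fun ⟨⟨hl, h⟩, _, h'⟩ => ⟨hl, fun r hr => ⟨h r hr, h' r hr⟩⟩

lemma tleq_antisymm {A B : List ℕ × List ℕ} (hA : A.1.length = A.2.length)
    (hB : B.1.length = B.2.length) (hAB : tleq A B) (hBA : tleq B A) : A = B := by
  have hl : A.1.length = B.1.length := le_antisymm hBA.1 hAB.1
  refine Prod.ext (List.ext_getElem hl fun r h h' => ?_)
    (List.ext_getElem (by omega) fun r h h' => ?_)
  · have := (hAB.2 r h').1
    have := (hBA.2 r h).1
    rw [List.getD_eq_getElem _ _ h, List.getD_eq_getElem _ _ h'] at *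
    omega
  · have := (hAB.2 r (by omega)).2
    have := (hBA.2 r (by omega)).2
    rw [List.getD_eq_getElem _ _ h, List.getD_eq_getElem _ _ h'] at *
    omega

lemma eq_of_pairwise_lt_of_mem_iff {K L : List ℕ} (hK : K.Pairwise (· < ·))
    (hL : L.Pairwise (· < ·)) (h : ∀ x, x ∈ K ↔ x ∈ L) : K = L :=
  ((List.perm_ext_iff_of_nodup (nodup_of_pairwise_lt hK) (nodup_of_pairwise_lt hL)).2
    h).eq_of_pairwise (fun _ _ _ _ h h' => absurd h h'.asymm) hK hL

lemma xi_nil_nil (n m : ℕ) : xi n m [] [] = topL n m := by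
  refine eq_of_pairwise_lt_of_mem_iff (pairwise_xi [] List.Pairwise.nil (by simp)) ?_ fun x => ?_
  · rw [topL, List.pairwise_map]
    exact List.pairwise_lt_range.imp (by omega)
  · simp only [mem_xi, topL, List.mem_map, List.mem_range, List.not_mem_nil, false_or,
      not_false_eq_true, and_true]
    constructor
    · rintro ⟨c, hc, rfl⟩
      exact ⟨n - c, by omega, by omega⟩
    · rintro ⟨r, hr, rfl⟩
      exact ⟨n - r, by omega, by omega⟩

lemma exists_isTab_xi_eq {n m : ℕ} {K : List ℕ} (hlen : K.length = n)
    (hK : K.Pairwise (· < ·)) (hKb : ∀ x ∈ K, 1 ≤ x ∧ x ≤ m + n) (htop : K ≠ topL n m) :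
    ∃ I J : List ℕ, isTab n m I J ∧ xi n m I J = K := by
  set J := K.filter (· ≤ m) with hJ
  set I := complList n (K.map fun x => m + n + 1 - x) with hI
  have memI : ∀ c, c ∈ I ↔ (1 ≤ c ∧ c ≤ n) ∧ m + (n + 1 - c) ∉ K := by
    intro c
    rw [hI, mem_complList, List.mem_map]
    refine and_congr_right fun hc => not_congr ⟨?_, fun h => ⟨_, h, by omega⟩⟩
    rintro ⟨x, hx, rfl⟩
    have := hKb x hx
    convert hx using 1
    omega
  have memJ : ∀ x, x ∈ J ↔ x ∈ K ∧ x ≤ m := by simp [hJ]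
  have hIp : I.Pairwise (· < ·) := pairwise_complList _ _
  have hJp : J.Pairwise (· < ·) := hK.filter _
  have hIn : ∀ x ∈ I, 1 ≤ x ∧ x ≤ n := fun x hx => ((memI x).1 hx).1
  have hxi : xi n m I J = K := by
    refine eq_of_pairwise_lt_of_mem_iff
      (pairwise_xi I hJp fun x hx => ((memJ x).1 hx).2) hK fun x => ?_
    rw [mem_xi, memJ]
    constructor
    · rintro (h | ⟨c, ⟨hc, hcI⟩, rfl⟩)
      · exact h.1
      · rw [memI] at hcI
        tauto
    · intro hx
      have hb := hKb x hx
      rcases le_or_gt x m with h | h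
      · exact Or.inl ⟨hx, h⟩
      · have hx' : m + (n + 1 - (m + n + 1 - x)) = x := by omega
        refine Or.inr ⟨m + n + 1 - x, ⟨by omega, fun hc => ?_⟩, hx'⟩
        have := ((memI _).1 hc).2
        rw [hx'] at this
        exact this hx
  have hIJ : I.length = J.length := by
    have h1 := length_xi n m I J
    have h2 := length_add_length_complList hIp hIn
    rw [hxi] at h1
    omega
  refine ⟨I, J, ⟨hIJ, fun h0 => htop ?_, List.isChain_iff_pairwise.2 hIp,
    List.isChain_iff_pairwise.2 hJp, hIn,
    fun x hx => ⟨(hKb x ((memJ x).1 hx).1).1, ((memJ x).1 hx).2⟩⟩, hxi⟩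
  have hJ0 : J = [] := by
    rw [h0] at hIJ
    exact List.length_eq_zero_iff.1 hIJ.symm
  rw [← hxi, h0, hJ0, xi_nil_nil]

lemma isTab.xi_ne_topL {n m : ℕ} {I J : List ℕ} (h : isTab n m I J) :
    xi n m I J ≠ topL n m := by
  intro he
  obtain ⟨hlen, hne, -, -, -, hJm⟩ := h
  have hJ : J ≠ [] := by
    rintro rfl
    exact hne (List.length_eq_zero_iff.1 hlen)
  obtain ⟨x, hx⟩ := List.exists_mem_of_ne_nil J hJ
  have hx' : x ∈ topL n m := he ▸ mem_xi.2 (Or.inl hx)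
  simp only [topL, List.mem_map, List.mem_range] at hx'
  obtain ⟨r, -, rfl⟩ := hx'
  have := hJm _ hx
  omega

/-- Lemma `double2single`. The map \xi is an order isomorphism from
`(D(n,m), ⪯)` onto the subposet of `L(n,m+n)` of all elements of length `n` except
`[m+1,…,m+n]`: it lands in that set, is injective, is onto, and both it and its inverse
are order preserving. -/
theorem xi_is_order_isomorphism (n m : ℕ) (hn : 0 < n) (hm : 0 < m) :
    (∀ I J : List ℕ, isTab n m I J →
      (xi n m I J).length = n ∧ (xi n m I J).Chain' (· < ·) ∧
        (∀ x ∈ xi n m I J, 1 ≤ x ∧ x ≤ m + n) ∧ xi n m I J ≠ topL n m) ∧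
    (∀ A B : List ℕ × List ℕ, isTab n m A.1 A.2 → isTab n m B.1 B.2 →
      xi n m A.1 A.2 = xi n m B.1 B.2 → A = B) ∧
    (∀ K : List ℕ, K.length = n → K.Chain' (· < ·) → (∀ x ∈ K, 1 ≤ x ∧ x ≤ m + n) →
      K ≠ topL n m → ∃ I J : List ℕ, isTab n m I J ∧ xi n m I J = K) ∧
    (∀ A B : List ℕ × List ℕ, isTab n m A.1 A.2 → isTab n m B.1 B.2 →
      (tleq A B ↔ ∀ r < n, (xi n m A.1 A.2).getD r 0 ≤ (xi n m B.1 B.2).getD r 0)) := by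
  refine ⟨fun I J h => ⟨h.length_xi, List.isChain_iff_pairwise.2 h.pairwise_xi, ?_, h.xi_ne_topL⟩,
    fun A B hA hB h => ?_, fun K hlen hK => exists_isTab_xi_eq hlen (List.isChain_iff_pairwise.1 hK),
    fun A B hA hB => tleq_iff_xi_le hA hB⟩
  · intro x hx
    rcases mem_xi.1 hx with hx | ⟨c, hc, rfl⟩
    · have := h.2.2.2.2.2 x hx
      omega
    · omega
  · exact tleq_antisymm hA.1 hB.1 ((tleq_iff_xi_le hA hB).2 fun r _ => (congrArg (·.getD r 0) h).le)
      ((tleq_iff_xi_le hB hA).2 fun r _ => (congrArg (·.getD r 0) h).ge)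

end
end

section
/- For every multichain J_1 ⪯ J_2 ⪯ … ⪯ J_u in L(m,m), the GT pattern of GL_m corresponding to the semistandard tableau whose columns are J_1,…,J_u equals the sum Σ_{k=1}^u p_{J_k}; moreover for all J, J' ∈ L(m,m), one has p_J + p_{J'} = p_{J∧J'} + p_{J∨J'}. -/
noncomputable section

/-- `inGT m (i,j)` : `z_j^{(i)}` is a point of the Gelfand–Tsetlin poset Γ_m. -/
def inGT (m : ℕ) (z : ℕ × ℕ) : Prop := 1 ≤ z.2 ∧ z.2 ≤ z.1 ∧ z.1 ≤ m

/-- The Gelfand–Tsetlin order: `gtLE (a,b) (i,j)` means `z_b^{(a)} ≤ z_j^{(i)}` in the partial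
order generated by `z_j^{(i+1)} ≥ z_j^{(i)} ≥ z_{j+1}^{(i+1)}`. -/
def gtLE (z w : ℕ × ℕ) : Prop := w.2 ≤ z.2 ∧ z.1 + w.2 ≤ w.1 + z.2

/-- A GT pattern of `GL_m` : an order preserving map Γ_m → ℤ_{≥0}
(extended by 0 off the poset). -/
def IsGTPattern (m : ℕ) (p : ℕ × ℕ → ℕ) : Prop :=
  (∀ z, ¬ inGT m z → p z = 0) ∧
    ∀ z w, inGT m z → inGT m w → gtLE z w → p z ≤ p w

/-- `pCol m J` is the GT pattern of `GL_m` corresponding (via the bijection of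
[pattern2tableau]) to the single-column semistandard tableau with entries `J`. -/
def pCol (m : ℕ) (J : List ℕ) : ℕ × ℕ → ℕ := fun z =>
  if 1 ≤ z.2 ∧ z.2 ≤ z.1 ∧ z.1 ≤ m ∧ z.2 ≤ J.countP (fun x => decide (x ≤ z.1)) then 1 else 0

/-- The order on `L(m,m)` (columns identified with their `J`-part). -/
def colLe (J J' : List ℕ) : Prop :=
  J'.length ≤ J.length ∧ ∀ r < J'.length, J.getD r 0 ≤ J'.getD r 0

/-- The meet `J ∧ J'` in the distributive lattice `L(m,m)`. -/
def colMeet (J J' : List ℕ) : List ℕ :=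
  List.zipWith min J J' ++
    (if J'.length ≤ J.length then J.drop J'.length else J'.drop J.length)

/-- The join `J ∨ J'` in the distributive lattice `L(m,m)`. -/
def colJoin (J J' : List ℕ) : List ℕ := List.zipWith max J J'

/-- `J` is an element of `L(m,m)` : a nonempty strictly increasing sequence in `{1,…,m}`. -/
def isCol (m : ℕ) (J : List ℕ) : Prop :=
  J ≠ [] ∧ J.Chain' (· < ·) ∧ ∀ x ∈ J, 1 ≤ x ∧ x ≤ m

theorem getD_eq_zero {J : List ℕ} {r : ℕ} (h : J.length ≤ r) : J.getD r 0 = 0 :=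
  List.getD_eq_default _ _ h

theorem lt_countP_le_iff {J : List ℕ} (hJ : J.Pairwise (· < ·)) (i r : ℕ) :
    r < J.countP (fun x => decide (x ≤ i)) ↔ r < J.length ∧ J.getD r 0 ≤ i := by
  induction J generalizing r with
  | nil => simp
  | cons a J ih =>
    rw [List.pairwise_cons] at hJ
    by_cases ha : a ≤ i
    · cases r with
      | zero => simp [ha]
      | succ r => simpa [ha] using ih hJ.2 r
    · have h0 : (a :: J).countP (fun x => decide (x ≤ i)) = 0 := by
        rw [List.countP_eq_zero]
        intro x hx
        rcases List.mem_cons.1 hx with rfl | hx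
        · simpa using ha
        · have := hJ.1 x hx
          simp only [decide_eq_true_eq]
          omega
      rw [h0]
      cases r with
      | zero => simp; omega
      | succ r =>
        simp only [not_lt_zero, List.length_cons, add_lt_add_iff_right, List.getD_cons_succ,
          false_iff, not_and]
        intro hr
        have := hJ.1 _ (List.getElem_mem hr)
        rw [List.getD_eq_getElem _ _ hr]
        omega

theorem pairwise_lt_iff_getD {J : List ℕ} :
    J.Pairwise (· < ·) ↔ ∀ r s, r < s → s < J.length → J.getD r 0 < J.getD s 0 := by
  rw [List.pairwise_iff_getElem]
  constructor
  · intro h r s hrs hs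
    rw [List.getD_eq_getElem _ _ hs, List.getD_eq_getElem _ _ (hrs.trans hs)]
    exact h r s _ _ hrs
  · intro h r s hr hs hrs
    simpa [List.getD_eq_getElem, hr, hs] using h r s hrs hs

theorem getD_add_le {J : List ℕ} (hJ : J.Pairwise (· < ·)) (r d : ℕ) (h : r + d < J.length) :
    J.getD r 0 + d ≤ J.getD (r + d) 0 := by
  induction d with
  | zero => simp
  | succ d ih =>
    have h₁ := ih (by omega)
    have h₂ := pairwise_lt_iff_getD.1 hJ (r + d) (r + (d + 1)) (by omega) h
    omega

theorem isCol.pairwise {m : ℕ} {J : List ℕ} (hJ : isCol m J) : J.Pairwise (· < ·) :=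
  List.isChain_iff_pairwise.1 hJ.2.1

theorem isCol.one_le_getD {m : ℕ} {J : List ℕ} (hJ : isCol m J) {r : ℕ} (hr : r < J.length) :
    1 ≤ J.getD r 0 ∧ J.getD r 0 ≤ m := by
  rw [List.getD_eq_getElem _ _ hr]
  exact hJ.2.2 _ (List.getElem_mem hr)

theorem isCol.succ_le_getD {m : ℕ} {J : List ℕ} (hJ : isCol m J) {r : ℕ} (hr : r < J.length) :
    r + 1 ≤ J.getD r 0 := by
  have h₁ := getD_add_le hJ.pairwise 0 r (by omega)
  have h₂ := (hJ.one_le_getD (r := 0) (by omega)).1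
  rw [zero_add] at h₁
  omega

theorem pCol_of_pairwise {m : ℕ} {J : List ℕ} (hJ : J.Pairwise (· < ·)) (i r : ℕ) :
    pCol m J (i, r + 1) =
      if r + 1 ≤ i ∧ i ≤ m ∧ r < J.length ∧ J.getD r 0 ≤ i then 1 else 0 := by
  have h := lt_countP_le_iff hJ i r
  simp only [pCol, Nat.succ_le_iff, h]
  simp

theorem pCol_le_one (m : ℕ) (J : List ℕ) (z : ℕ × ℕ) : pCol m J z ≤ 1 := by
  unfold pCol
  split_ifs <;> simp

theorem pCol_eq_zero {m : ℕ} {z : ℕ × ℕ} (hz : ¬ inGT m z) (J : List ℕ) : pCol m J z = 0 :=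
  if_neg fun h => hz ⟨h.1, h.2.1, h.2.2.1⟩

theorem pCol_mono {m : ℕ} {J : List ℕ} (hJ : J.Pairwise (· < ·)) {z w : ℕ × ℕ}
    (hz : inGT m z) (hw : inGT m w) (hzw : gtLE z w) : pCol m J z ≤ pCol m J w := by
  obtain ⟨a, b⟩ := z
  obtain ⟨i, j⟩ := w
  simp only [inGT, gtLE] at hz hw hzw
  obtain ⟨s, rfl⟩ : ∃ s, j = s + 1 := ⟨j - 1, by omega⟩
  obtain ⟨d, rfl⟩ : ∃ d, b = s + d + 1 := ⟨b - 1 - s, by omega⟩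
  rw [pCol_of_pairwise hJ, pCol_of_pairwise hJ]
  split_ifs with h₁ h₂
  · rfl
  · have := getD_add_le hJ s d h₁.2.2.1
    omega
  · omega
  · rfl

theorem pCol_antitone {m : ℕ} {J J' : List ℕ} (hJ : J.Pairwise (· < ·))
    (hJ' : J'.Pairwise (· < ·)) (h : colLe J J') (i r : ℕ) :
    pCol m J' (i, r + 1) ≤ pCol m J (i, r + 1) := by
  rw [pCol_of_pairwise hJ, pCol_of_pairwise hJ']
  have h₁ := h.1
  have h₂ := h.2 r
  split_ifs <;> omega

theorem colLe_trans {J₁ J₂ J₃ : List ℕ} (h : colLe J₁ J₂) (h' : colLe J₂ J₃) : colLe J₁ J₃ :=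
  ⟨h'.1.trans h.1, fun r hr => (h.2 r (hr.trans_le h'.1)).trans (h'.2 r hr)⟩

instance : IsTrans (List ℕ) colLe := ⟨fun _ _ _ => colLe_trans⟩

theorem lt_sum_iff_of_pairwise_ge {L : List ℕ} (hL : L.Pairwise (· ≥ ·)) (h1 : ∀ x ∈ L, x ≤ 1)
    (c : ℕ) : c < L.sum ↔ L.getD c 0 = 1 := by
  induction L generalizing c with
  | nil => simp
  | cons a L ih =>
    rw [List.pairwise_cons] at hL
    have ih' := fun c => ih hL.2 (fun x hx => h1 x (List.mem_cons_of_mem _ hx)) c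
    have ha : a ≤ 1 := h1 a List.mem_cons_self
    cases c with
    | zero =>
      rw [List.sum_cons, List.getD_cons_zero]
      have h0 : a = 0 → L.sum = 0 := fun h =>
        List.sum_eq_zero fun x hx => by have := hL.1 x hx; omega
      omega
    | succ c =>
      rw [List.sum_cons, List.getD_cons_succ, ← ih']
      have h0 : a = 0 → L.sum = 0 := fun h =>
        List.sum_eq_zero fun x hx => by have := hL.1 x hx; omega
      omega

theorem lt_sum_pCol_iff {m : ℕ} {Js : List (List ℕ)} (hJs : ∀ J ∈ Js, isCol m J)
    (hc : Js.Pairwise colLe) (i r c : ℕ) :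
    c < (Js.map fun J => pCol m J (i, r + 1)).sum ↔
      i ≤ m ∧ r < (Js.getD c []).length ∧ (Js.getD c []).getD r 0 ≤ i := by
  rw [lt_sum_iff_of_pairwise_ge]
  · by_cases h : c < Js.length
    · have hJ := hJs _ (List.getElem_mem h)
      rw [List.getD_eq_getElem _ _ (by simpa using h), List.getD_eq_getElem _ _ h,
        List.getElem_map, pCol_of_pairwise hJ.pairwise]
      have : r < Js[c].length → r + 1 ≤ Js[c].getD r 0 := hJ.succ_le_getD
      split_ifs <;> grind
    · rw [List.getD_eq_default _ _ (by simpa using h), List.getD_eq_default _ _ (by omega)]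
      simp
  · rw [List.pairwise_map]
    exact hc.imp_of_mem fun hJ hJ' h =>
      pCol_antitone (hJs _ hJ).pairwise (hJs _ hJ').pairwise h i r
  · intro x hx
    obtain ⟨J, -, rfl⟩ := List.mem_map.1 hx
    exact pCol_le_one m J _

theorem isGTPattern_sum_pCol {m : ℕ} {Js : List (List ℕ)} (hJs : ∀ J ∈ Js, isCol m J) :
    IsGTPattern m (fun z => (Js.map fun J => pCol m J z).sum) := by
  constructor
  · intro z hz
    simp [pCol_eq_zero hz]
  · intro z w hz hw hzw
    exact List.sum_le_sum fun J hJ => pCol_mono (hJs J hJ).pairwise hz hw hzw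

theorem sInf_lt_sum_pCol {m : ℕ} {Js : List (List ℕ)} (hJs : ∀ J ∈ Js, isCol m J)
    (hc : Js.Pairwise colLe) (r c : ℕ) :
    sInf {i | c < (Js.map fun J => pCol m J (i, r + 1)).sum} = (Js.getD c []).getD r 0 := by
  simp only [lt_sum_pCol_iff hJs hc]
  by_cases hr : r < (Js.getD c []).length
  · have h : c < Js.length := by
      by_contra h
      rw [List.getD_eq_default _ _ (by omega)] at hr
      simp at hr
    have hJ : isCol m (Js.getD c []) := by
      rw [List.getD_eq_getElem _ _ h]
      exact hJs _ (List.getElem_mem h)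
    exact IsLeast.csInf_eq ⟨⟨(hJ.one_le_getD hr).2, hr, le_rfl⟩, fun i hi => hi.2.2⟩
  · simp only [getD_eq_zero (not_lt.1 hr), hr, false_and, and_false, Set.ofPred_false,
      Nat.sInf_empty]

theorem length_colMeet (J J' : List ℕ) :
    (colMeet J J').length = max J.length J'.length := by
  unfold colMeet
  split_ifs <;> simp <;> omega

theorem getD_colMeet (J J' : List ℕ) (r : ℕ) :
    (colMeet J J').getD r 0 = if r < J.length ∧ r < J'.length then
      min (J.getD r 0) (J'.getD r 0) else max (J.getD r 0) (J'.getD r 0) := by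
  unfold colMeet
  split_ifs <;> grind

theorem length_colJoin (J J' : List ℕ) :
    (colJoin J J').length = min J.length J'.length := by
  simp [colJoin]

theorem getD_colJoin (J J' : List ℕ) (r : ℕ) (h : r < J.length) (h' : r < J'.length) :
    (colJoin J J').getD r 0 = max (J.getD r 0) (J'.getD r 0) := by
  unfold colJoin
  grind

theorem pairwise_colMeet {J J' : List ℕ} (hJ : J.Pairwise (· < ·)) (hJ' : J'.Pairwise (· < ·)) :
    (colMeet J J').Pairwise (· < ·) := by
  rw [pairwise_lt_iff_getD] at *
  intro r s hrs hs
  rw [length_colMeet] at hs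
  rw [getD_colMeet, getD_colMeet]
  have h₁ := hJ r s hrs
  have h₂ := hJ' r s hrs
  have h₃ := @getD_eq_zero J r
  have h₄ := @getD_eq_zero J' r
  have h₅ := @getD_eq_zero J s
  have h₆ := @getD_eq_zero J' s
  split_ifs <;> omega

theorem pairwise_colJoin {J J' : List ℕ} (hJ : J.Pairwise (· < ·)) (hJ' : J'.Pairwise (· < ·)) :
    (colJoin J J').Pairwise (· < ·) := by
  rw [pairwise_lt_iff_getD] at *
  intro r s hrs hs
  rw [length_colJoin] at hs
  rw [getD_colJoin _ _ r (by omega) (by omega), getD_colJoin _ _ s (by omega) (by omega)]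
  have h₁ := hJ r s hrs
  have h₂ := hJ' r s hrs
  omega

theorem pCol_add_pCol {m : ℕ} {J J' : List ℕ} (hJ : J.Pairwise (· < ·))
    (hJ' : J'.Pairwise (· < ·)) :
    pCol m J + pCol m J' = pCol m (colMeet J J') + pCol m (colJoin J J') := by
  ext ⟨i, j⟩
  simp only [Pi.add_apply]
  cases j with
  | zero => simp [pCol]
  | succ r =>
    rw [pCol_of_pairwise hJ, pCol_of_pairwise hJ', pCol_of_pairwise (pairwise_colMeet hJ hJ'),
      pCol_of_pairwise (pairwise_colJoin hJ hJ'), length_colMeet, length_colJoin, getD_colMeet]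
    have h₁ := getD_colJoin J J' r
    have h₂ := @getD_eq_zero J r
    have h₃ := @getD_eq_zero J' r
    by_cases a : r < J.length <;> by_cases b : r < J'.length <;> grind

/-- (a) For every multichain `J₁ ⪯ ⋯ ⪯ J_u` in `L(m,m)`, the sum
`∑_k p_{J_k}` is the GT pattern corresponding to the semistandard tableau whose columns are
`J₁,…,J_u` (i.e. it is a GT pattern and the bijection of [pattern2tableau] sends it to the
tableau whose entry at row `r`, column `c` is the `(r+1)`-st entry of `J_{c+1}`).
(b) For all `J, J' ∈ L(m,m)`, `p_J + p_{J'} = p_{J∧J'} + p_{J∨J'}`. -/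
theorem pattern_sum_of_multichain_and_meet_join (m : ℕ) (hm : 0 < m) :
    (∀ Js : List (List ℕ), (∀ J ∈ Js, isCol m J) → Js.Chain' colLe →
      IsGTPattern m (fun z => (Js.map fun J => pCol m J z).sum) ∧
        ∀ r c : ℕ, sInf {i | c < (Js.map fun J => pCol m J (i, r + 1)).sum} =
          (Js.getD c []).getD r 0) ∧
    ∀ J J' : List ℕ, isCol m J → isCol m J' →
      pCol m J + pCol m J' = pCol m (colMeet J J') + pCol m (colJoin J J') := by
  refine ⟨fun Js hJs hc => ⟨isGTPattern_sum_pCol hJs, ?_⟩, fun J J' hJ hJ' =>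
    pCol_add_pCol hJ.pairwise hJ'.pairwise⟩
  exact sInf_lt_sum_pCol hJs (List.isChain_iff_pairwise.1 hc)

end
end

section
/- For K, K' ∈ Pl(n,m+n), the product δ_K δ_{K'} ∈ ℂ[M_{n,m+n}] can be uniquely expressed as a ℂ-linear combination δ_K δ_{K'} = Σ_r c_r δ_{T_r} δ_{T'_r} with T_r ⪯ T'_r in Pl(n,m+n) for each r. In this expression the term δ_{K∧K'} δ_{K∨K'} appears with coefficient 1, T_r ⪯ K∧K' ⪯ K∨K' ⪯ T'_r for all r, and for each (T_r, T'_r) ≠ (K∧K', K∨K'), if a is the smallest index such that the sum s of the a-th entries of T_r and T'_r differs from the sum s_0 of the a-th entries of K and K', then s > s_0. -/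
noncomputable section

/-- `dmin n m I J` is the minor δ_{[I:J]} ∈ ℂ[M_{n,m}] : the determinant of the submatrix of
the generic n×m matrix of variables with rows `I` and columns `J` (1-based indices). -/
def dmin (n m : ℕ) (I J : List ℕ) : MvPolynomial (Fin n × Fin m) ℂ :=
  Matrix.det (Matrix.of fun a b : Fin I.length =>
    if h : I.getD a 0 - 1 < n ∧ J.getD b 0 - 1 < m then
      MvPolynomial.X (⟨I.getD a 0 - 1, h.1⟩, ⟨J.getD b 0 - 1, h.2⟩)
    else 0)

/-- `memPl n M K` : `K` is a strictly increasing sequence of length `n` in `{1,…,M}`,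
i.e. an element of `Pl(n,M)`. -/
def memPl (n M : ℕ) (K : List ℕ) : Prop :=
  K.length = n ∧ K.Chain' (· < ·) ∧ ∀ x ∈ K, 1 ≤ x ∧ x ≤ M

/-- The maximal minor δ_K ∈ ℂ[M_{n,m+n}], with all `n` rows and columns `K`. -/
def pld (n m : ℕ) (K : List ℕ) : MvPolynomial (Fin n × Fin (m + n)) ℂ :=
  dmin n (m + n) ((List.range n).map (· + 1)) K

open MvPolynomial in
/-- The maximal minor of the generic `n × N` matrix on the (not necessarily sorted)
columns `f`. -/
noncomputable def colMinor {n N : ℕ} (f : Fin n → Fin N) : MvPolynomial (Fin n × Fin N) ℂ :=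
  Matrix.det (Matrix.of fun i j => X (i, f j))

/-- The monomial `∏ i, x (i, h i)`, as an exponent vector. -/
noncomputable def rowMon {n N : ℕ} (h : Fin n → Fin N) : (Fin n × Fin N) →₀ ℕ :=
  ∑ i, Finsupp.single (i, h i) 1

/-- Pairs of strictly increasing column sequences with the first one below the second one. -/
def stdPairs (n N : ℕ) : Set ((Fin n → Fin N) × (Fin n → Fin N)) :=
  {P | StrictMono P.1 ∧ StrictMono P.2 ∧ P.1 ≤ P.2}

/-- The sequence of row sums of a pair of column sequences, ordered lexicographically. -/
def rowSum {n N : ℕ} (P : (Fin n → Fin N) × (Fin n → Fin N)) : Lex (Fin n → ℕ) :=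
  toLex fun i => (P.1 i : ℕ) + P.2 i

section Monomials

variable {n N : ℕ}

lemma rowMon_apply (h : Fin n → Fin N) (i : Fin n) (j : Fin N) :
    rowMon h (i, j) = if h i = j then 1 else 0 := by
  simp only [rowMon, Finsupp.coe_finsetSum, Finset.sum_apply, Finsupp.single_apply,
    Prod.mk.injEq]
  rw [Finset.sum_eq_single i] <;> aesop

lemma rowMon_add_weight (f g : Fin n → Fin N) (i : Fin n) :
    ∑ j : Fin N, (j : ℕ) * (rowMon f + rowMon g) (i, j) = f i + g i := by
  simp [rowMon_apply, mul_add, Finset.sum_add_distrib]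

lemma rowMon_add_eq_sum {p p' q q' : Fin n → Fin N}
    (h : rowMon p + rowMon p' = rowMon q + rowMon q') (i : Fin n) :
    (p i : ℕ) + p' i = q i + q' i := by
  rw [← rowMon_add_weight, ← rowMon_add_weight, h]

lemma rowMon_add_eq_or {p p' q q' : Fin n → Fin N}
    (h : rowMon p + rowMon p' = rowMon q + rowMon q') (i : Fin n) :
    q i = p i ∧ q' i = p' i ∨ q i = p' i ∧ q' i = p i := by
  have h1 := rowMon_add_eq_sum h i
  have h2 := DFunLike.congr_fun h (i, q i)
  simp only [Finsupp.add_apply, rowMon_apply, if_true] at h2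
  by_cases e1 : p i = q i
  · left
    exact ⟨e1.symm, by rw [e1] at h1; exact Fin.ext (by omega)⟩
  · by_cases e2 : p' i = q i
    · right
      exact ⟨e2.symm, by rw [e2] at h1; exact Fin.ext (by omega)⟩
    · simp only [e1, e2, if_false] at h2
      omega

lemma rowMon_inf_add_sup (f g : Fin n → Fin N) :
    rowMon (f ⊓ g) + rowMon (f ⊔ g) = rowMon f + rowMon g := by
  ext ⟨i, j⟩
  rcases le_total (f i) (g i) with h | h
  · simp [rowMon_apply, h]
  · simp [rowMon_apply, h, add_comm]

lemma eq_of_rowMon_add_eq {P Q : (Fin n → Fin N) × (Fin n → Fin N)} (hP : P.1 ≤ P.2)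
    (hQ : Q.1 ≤ Q.2) (h : rowMon P.1 + rowMon P.2 = rowMon Q.1 + rowMon Q.2) : P = Q := by
  have key (i : Fin n) : P.1 i = Q.1 i ∧ P.2 i = Q.2 i := by
    have h1 := hP i
    have h2 := hQ i
    rcases rowMon_add_eq_or h i with ⟨e1, e2⟩ | ⟨e1, e2⟩
    · exact ⟨e1.symm, e2.symm⟩
    · rw [e1, e2] at h2
      have := le_antisymm h1 h2
      exact ⟨by rw [e1, this], by rw [e2, this]⟩
  exact Prod.ext (funext fun i => (key i).1) (funext fun i => (key i).2)

lemma rowSum_le_and_eq {p p' q q' : Fin n → Fin N} (hq : StrictMono q) (hq' : StrictMono q')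
    {σ τ : Equiv.Perm (Fin n)} (h : rowMon p + rowMon p' = rowMon (q ∘ σ) + rowMon (q' ∘ τ)) :
    rowSum (q, q') ≤ rowSum (p, p') ∧
      (rowSum (q, q') = rowSum (p, p') → σ = 1 ∧ τ = 1) := by
  have hs (i) : (p i : ℕ) + p' i = q (σ i) + q' (τ i) := rowMon_add_eq_sum h i
  have hge (ρ : Equiv.Perm (Fin n)) (i : Fin n) (hi : ∀ b < i, ρ b = b) : i ≤ ρ i := by
    by_contra! hlt
    exact hlt.ne (ρ.injective (hi _ hlt))
  have hle (i : Fin n) (hi : ∀ b < i, σ b = b ∧ τ b = b) : q i ≤ q (σ i) ∧ q' i ≤ q' (τ i) :=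
    ⟨hq.monotone (hge σ i fun b hb => (hi b hb).1), hq'.monotone (hge τ i fun b hb => (hi b hb).2)⟩
  have hstep (i : Fin n) (hi : ∀ b < i, σ b = b ∧ τ b = b)
      (he : (p i : ℕ) + p' i = q i + q' i) : σ i = i ∧ τ i = i := by
    have h1 : (q i : ℕ) ≤ q (σ i) := (hle i hi).1
    have h2 : (q' i : ℕ) ≤ q' (τ i) := (hle i hi).2
    have h3 := hs i
    exact ⟨hq.injective (Fin.ext (by omega)), hq'.injective (Fin.ext (by omega))⟩
  have hfix (i : Fin n) (hi : ∀ b < i, (p b : ℕ) + p' b = q b + q' b) :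
      ∀ b < i, σ b = b ∧ τ b = b := by
    intro b
    induction b using WellFoundedLT.induction with
    | ind b ih => exact fun hb => hstep b (fun c hc => ih c hc (hc.trans hb)) (hi b hb)
  constructor
  · by_contra! hlt
    obtain ⟨i, hi, hlt⟩ := hlt
    have h1 := hle i (hfix i hi)
    have h2 := hs i
    change (p i : ℕ) + p' i < q i + q' i at hlt
    simp only [Fin.le_def] at h1
    omega
  · intro he
    have he' (i) : (p i : ℕ) + p' i = q i + q' i := (congrFun he i).symm
    have hst (i : Fin n) := hstep i (hfix i fun b _ => he' b) (he' i)
    exact ⟨Equiv.ext fun i => (hst i).1, Equiv.ext fun i => (hst i).2⟩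

lemma exists_ge_perm_le (σ : Equiv.Perm (Fin n)) (i : Fin n) : ∃ k, i ≤ k ∧ σ k ≤ i := by
  by_contra! h
  have := Finset.card_le_card_of_injOn (s := Finset.Ici i) (t := Finset.Ioi i) σ
    (fun k hk => by simpa using h k (by simpa using hk)) σ.injective.injOn
  simp only [Fin.card_Ici, Fin.card_Ioi] at this
  omega

lemma exists_le_perm_ge (σ : Equiv.Perm (Fin n)) (i : Fin n) : ∃ k, k ≤ i ∧ i ≤ σ k := by
  obtain ⟨k, hk, hki⟩ := exists_ge_perm_le σ⁻¹ i
  exact ⟨σ⁻¹ k, hki, by simpa using hk⟩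

lemma le_of_forall_le_perm {α : Type*} [Preorder α] {t q : Fin n → α} (ht : Monotone t)
    (hq : Monotone q) (σ : Equiv.Perm (Fin n)) (h : ∀ i, t i ≤ q (σ i)) : t ≤ q := fun i => by
  obtain ⟨k, hk, hki⟩ := exists_ge_perm_le σ i
  exact (ht hk).trans ((h k).trans (hq hki))

lemma le_of_forall_perm_le {α : Type*} [Preorder α] {t q : Fin n → α} (ht : Monotone t)
    (hq : Monotone q) (σ : Equiv.Perm (Fin n)) (h : ∀ i, q (σ i) ≤ t i) : q ≤ t := fun i => by
  obtain ⟨k, hk, hki⟩ := exists_le_perm_ge σ i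
  exact (hq hki).trans ((h k).trans (ht hk))

lemma le_of_rowMon_add_eq {t p p' q q' : Fin n → Fin N} {σ τ : Equiv.Perm (Fin n)}
    (ht : Monotone t) (hq : Monotone q) (hq' : Monotone q') (hp : t ≤ p) (hp' : t ≤ p')
    (h : rowMon p + rowMon p' = rowMon (q ∘ σ) + rowMon (q' ∘ τ)) : t ≤ q ∧ t ≤ q' := by
  constructor
  · refine le_of_forall_le_perm ht hq σ fun i => ?_
    rcases rowMon_add_eq_or h i with ⟨e, -⟩ | ⟨e, -⟩
    exacts [(hp i).trans_eq e.symm, (hp' i).trans_eq e.symm]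
  · refine le_of_forall_le_perm ht hq' τ fun i => ?_
    rcases rowMon_add_eq_or h i with ⟨-, e⟩ | ⟨-, e⟩
    exacts [(hp' i).trans_eq e.symm, (hp i).trans_eq e.symm]

lemma ge_of_rowMon_add_eq {t p p' q q' : Fin n → Fin N} {σ τ : Equiv.Perm (Fin n)}
    (ht : Monotone t) (hq : Monotone q) (hq' : Monotone q') (hp : p ≤ t) (hp' : p' ≤ t)
    (h : rowMon p + rowMon p' = rowMon (q ∘ σ) + rowMon (q' ∘ τ)) : q ≤ t ∧ q' ≤ t := by
  constructor
  · refine le_of_forall_perm_le ht hq σ fun i => ?_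
    rcases rowMon_add_eq_or h i with ⟨e, -⟩ | ⟨e, -⟩
    exacts [e.trans_le (hp i), e.trans_le (hp' i)]
  · refine le_of_forall_perm_le ht hq' τ fun i => ?_
    rcases rowMon_add_eq_or h i with ⟨-, e⟩ | ⟨-, e⟩
    exacts [e.trans_le (hp' i), e.trans_le (hp i)]

end Monomials

section Coefficients

open MvPolynomial

variable {n N : ℕ}

lemma colMinor_mul_colMinor (f g : Fin n → Fin N) :
    colMinor f * colMinor g = ∑ σ : Equiv.Perm (Fin n), ∑ τ : Equiv.Perm (Fin n),
      monomial (rowMon (f ∘ σ) + rowMon (g ∘ τ))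
        (((Equiv.Perm.sign σ : ℤ) : ℂ) * ((Equiv.Perm.sign τ : ℤ) : ℂ)) := by
  have h (f : Fin n → Fin N) : colMinor f = ∑ σ : Equiv.Perm (Fin n),
      monomial (rowMon (f ∘ σ)) ((Equiv.Perm.sign σ : ℤ) : ℂ) := by
    rw [colMinor, ← Matrix.det_transpose, Matrix.det_apply']
    refine Finset.sum_congr rfl fun σ _ => ?_
    rw [rowMon, ← mul_one ((Equiv.Perm.sign σ : ℤ) : ℂ), ← C_mul_monomial, monomial_sum_one]
    simp [X]
  rw [h, h, Finset.sum_mul_sum]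
  simp only [monomial_mul]

lemma exists_of_coeff_ne_zero {f g : Fin n → Fin N} {μ : (Fin n × Fin N) →₀ ℕ}
    (h : coeff μ (colMinor f * colMinor g) ≠ 0) :
    ∃ σ τ : Equiv.Perm (Fin n), μ = rowMon (f ∘ σ) + rowMon (g ∘ τ) := by
  contrapose! h
  rw [colMinor_mul_colMinor, coeff_sum]
  refine Finset.sum_eq_zero fun σ _ => ?_
  rw [coeff_sum]
  refine Finset.sum_eq_zero fun τ _ => ?_
  rw [coeff_monomial, if_neg (h σ τ).symm]

lemma coeff_rowMon_add {f g : Fin n → Fin N} (hf : StrictMono f) (hg : StrictMono g) :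
    coeff (rowMon f + rowMon g) (colMinor f * colMinor g) = 1 := by
  have h (σ τ : Equiv.Perm (Fin n)) (e : rowMon (f ∘ σ) + rowMon (g ∘ τ) = rowMon f + rowMon g) :
      σ = 1 ∧ τ = 1 :=
    (rowSum_le_and_eq hf hg e.symm).2 rfl
  rw [colMinor_mul_colMinor, coeff_sum, Finset.sum_eq_single 1, coeff_sum,
    Finset.sum_eq_single 1]
  · simp
  · intro τ _ hτ
    rw [coeff_monomial, if_neg fun e => hτ (h _ _ e).2]
  · simp
  · intro σ _ hσ
    rw [coeff_sum]
    refine Finset.sum_eq_zero fun τ _ => ?_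
    rw [coeff_monomial, if_neg fun e => hσ (h _ _ e).1]
  · simp

/-- A triangularity principle: among the indices of a combination of polynomials satisfying
a hereditary condition `S`, one with minimal key has a coefficient that can be read off. -/
lemma exists_coeff_sum_eq {α κ τ : Type*} [LinearOrder κ] (c : α →₀ ℂ)
    (D : α → MvPolynomial τ ℂ) (μ : α → τ →₀ ℕ) (key : α → κ) (S : α → Prop)
    (hone : ∀ P ∈ c.support, coeff (μ P) (D P) = 1)
    (htri : ∀ P ∈ c.support, ∀ Q ∈ c.support, S P → coeff (μ P) (D Q) ≠ 0 →
      S Q ∧ key Q ≤ key P ∧ (key Q = key P → Q = P))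
    {Q₀ : α} (hQ₀ : Q₀ ∈ c.support) (hS : S Q₀) :
    ∃ P ∈ c.support, S P ∧ key P ≤ key Q₀ ∧
      coeff (μ P) (c.sum fun Q a => a • D Q) = c P := by
  classical
  obtain ⟨P, hP, hmin⟩ := Finset.exists_min_image (c.support.filter S) key
    ⟨Q₀, Finset.mem_filter.2 ⟨hQ₀, hS⟩⟩
  rw [Finset.mem_filter] at hP
  refine ⟨P, hP.1, hP.2, hmin _ (Finset.mem_filter.2 ⟨hQ₀, hS⟩), ?_⟩
  rw [Finsupp.sum, coeff_sum, Finset.sum_eq_single P]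
  · rw [coeff_smul, hone P hP.1, smul_eq_mul, mul_one]
  · intro Q hQ hne
    rw [coeff_smul, smul_eq_zero]
    right
    by_contra hc
    obtain ⟨h1, h2, h3⟩ := htri P hP.1 Q hQ hP.2 hc
    exact hne (h3 (h2.antisymm (hmin Q (Finset.mem_filter.2 ⟨hQ, h1⟩))))
  · exact fun h => absurd hP.1 h

end Coefficients

section Straightening

open MvPolynomial

variable {n N : ℕ}

/-- Replace the values of `f` at the indices satisfying `p` by those of `u`. -/
def overwrite {α : Type*} (p : Fin n → Prop) [DecidablePred p] (f : Fin n → α)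
    (u : {i // p i} → α) : Fin n → α :=
  fun i => if h : p i then u ⟨i, h⟩ else f i

lemma overwrite_perm {α : Type*} (p : Fin n → Prop) [DecidablePred p] (f : Fin n → α)
    (σ : Equiv.Perm {i // p i}) :
    overwrite p f (fun i => f (σ i)) = f ∘ Equiv.Perm.ofSubtype σ := by
  ext i
  by_cases h : p i
  · simp [overwrite, h, Equiv.Perm.ofSubtype_apply_of_mem]
  · simp [overwrite, h, Equiv.Perm.ofSubtype_apply_of_not_mem]

lemma colMinor_comp_perm (f : Fin n → Fin N) (σ : Equiv.Perm (Fin n)) :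
    colMinor (f ∘ σ) = ((Equiv.Perm.sign σ : ℤ) : MvPolynomial (Fin n × Fin N) ℂ) * colMinor f :=
  Matrix.det_permute' σ (Matrix.of fun i j => X (i, f j))

lemma colMinor_eq_zero {f : Fin n → Fin N} (hf : ¬ Function.Injective f) : colMinor f = 0 := by
  simp only [Function.Injective, not_forall] at hf
  obtain ⟨i, j, hij, hne⟩ := hf
  exact Matrix.det_zero_of_column_eq hne fun k => by simp [hij]

/-- Two maximal minors, each with some columns freed, as a multilinear map in those columns. -/
noncomputable def freedMinors {R : Type*} [CommRing R] (p q : Fin n → Prop) [DecidablePred p]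
    [DecidablePred q] (v w : Fin n → Fin n → R) :
    MultilinearMap R (fun _ : {i // p i} ⊕ {i // q i} => Fin n → R) R :=
  (LinearMap.mul' R R).compMultilinearMap
    (((Matrix.detRowAlternating (n := Fin n) (R := R)).toMultilinearMap.domDomRestrict p
        (fun i => v i)).domCoprod
      ((Matrix.detRowAlternating (n := Fin n) (R := R)).toMultilinearMap.domDomRestrict q
        (fun i => w i)))

lemma freedMinors_apply {R : Type*} [CommRing R] (p q : Fin n → Prop) [DecidablePred p]
    [DecidablePred q] (v w : Fin n → Fin n → R) (x : {i // p i} ⊕ {i // q i} → Fin n → R) :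
    freedMinors p q v w x = Matrix.det (overwrite p v fun i => x (.inl i)) *
      Matrix.det (overwrite q w fun i => x (.inr i)) :=
  rfl

/-- The Garnir relation: alternating a product of two minors over more columns than there are
rows gives zero. -/
lemma sum_sign_smul_colMinor_mul (p q : Fin n → Prop) [DecidablePred p] [DecidablePred q]
    (hpq : n < Fintype.card ({i // p i} ⊕ {i // q i})) (f g : Fin n → Fin N)
    (u : {i // p i} ⊕ {i // q i} → Fin N) :
    ∑ σ : Equiv.Perm ({i // p i} ⊕ {i // q i}), Equiv.Perm.sign σ •
      (colMinor (overwrite p f fun i => u (σ (.inl i))) *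
        colMinor (overwrite q g fun i => u (σ (.inr i)))) = 0 := by
  let col : Fin N → Fin n → MvPolynomial (Fin n × Fin N) ℂ := fun j i => X (i, j)
  have hcol (r : Fin n → Prop) [DecidablePred r] (h : Fin n → Fin N) (y : {i // r i} → Fin N) :
      Matrix.det (overwrite r (fun i => col (h i)) fun i => col (y i)) =
        colMinor (overwrite r h y) := by
    rw [colMinor, ← Matrix.det_transpose]
    congr 1
    refine Matrix.ext fun i j => ?_
    by_cases hi : r i <;> simp [overwrite, hi, col]
  have hzero := (MultilinearMap.alternatization
    (freedMinors p q (fun i => col (f i)) (fun i => col (g i)))).map_linearDependent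
      (fun x => col (u x)) fun hli => by
        have := hli.fintype_card_le_finrank
        rw [Module.finrank_fin_fun] at this
        omega
  rw [MultilinearMap.alternatization_apply] at hzero
  rw [← hzero]
  refine Finset.sum_congr rfl fun σ _ => ?_
  rw [MultilinearMap.domDomCongr_apply, freedMinors_apply, hcol, hcol]

lemma sum_overwrite_lt (p q : Fin n → Prop) [DecidablePred p] [DecidablePred q]
    (f : Fin n → Fin N) (u : {i // p i} ⊕ {i // q i} → Fin N) (hu : ∀ i, u (.inl i) = f i)
    (b : Fin N) (hp : ∀ i, b ≤ u (.inl i)) (hq : ∀ i, u (.inr i) < b)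
    (σ : Equiv.Perm ({i // p i} ⊕ {i // q i}))
    (hσ : ¬ Set.MapsTo σ (Set.range Sum.inl) (Set.range Sum.inl)) :
    ∑ i, ((overwrite p f (fun i => u (σ (.inl i))) i : Fin N) : ℕ) < ∑ i, (f i : ℕ) := by
  have hsplit (h : Fin n → Fin N) : ∑ i, (h i : ℤ) =
      ∑ i : {i // p i}, (h i : ℤ) + ∑ i : {i // ¬ p i}, (h i : ℤ) :=
    (Fintype.sum_subtype_add_sum_subtype p fun i => (h i : ℤ)).symm
  zify
  rw [hsplit, hsplit f]
  have h1 : ∑ i : {i // ¬ p i}, (((overwrite p f (fun i => u (σ (.inl i))) i : Fin N) : ℕ) : ℤ) =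
      ∑ i : {i // ¬ p i}, (f i : ℤ) :=
    Finset.sum_congr rfl fun i _ => by simp [overwrite, i.2]
  rw [h1, add_lt_add_iff_right]
  have h2 : ∑ i : {i // p i}, (((overwrite p f (fun i => u (σ (.inl i))) i : Fin N) : ℕ) : ℤ) =
      ∑ i : {i // p i}, (u (σ (.inl i)) : ℤ) :=
    Finset.sum_congr rfl fun i _ => by simp [overwrite, i.2]
  rw [h2]
  let v : {i // p i} ⊕ {i // q i} → ℤ := fun x => (u x : ℤ) - b
  have hv (i) : v (.inl i) = max (v (.inl i)) 0 :=
    (max_eq_left (sub_nonneg.2 (by exact_mod_cast hp i))).symm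
  have hv' (i) : v (.inr i) < 0 := sub_neg.2 (by exact_mod_cast hq i)
  suffices h : ∑ i : {i // p i}, v (σ (.inl i)) < ∑ i : {i // p i}, v (.inl i) by
    simp only [v, Finset.sum_sub_distrib, hu] at h
    linarith
  obtain ⟨j, y, hj⟩ : ∃ j y, σ (.inl j) = .inr y := by
    by_contra! h
    refine hσ ?_
    rintro _ ⟨j, rfl⟩
    rcases hx : σ (.inl j) with x | y
    exacts [⟨x, rfl⟩, absurd hx (h j y)]
  calc ∑ i : {i // p i}, v (σ (.inl i))
      < ∑ i : {i // p i}, max (v (σ (.inl i))) 0 :=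
        Finset.sum_lt_sum (fun _ _ => le_max_left _ _)
          ⟨j, Finset.mem_univ _, by rw [hj]; exact lt_max_of_lt_right (hv' y)⟩
    _ ≤ ∑ i : {i // p i}, max (v (σ (.inl i))) 0 + ∑ i : {i // q i}, max (v (σ (.inr i))) 0 :=
        le_add_of_nonneg_right (Finset.sum_nonneg fun _ _ => le_max_right _ _)
    _ = ∑ x, max (v x) 0 := by
        rw [← Fintype.sum_sum_type fun x => max (v (σ x)) 0]
        exact Equiv.sum_comp σ fun x => max (v x) 0
    _ = ∑ i : {i // p i}, v (.inl i) := by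
        rw [Fintype.sum_sum_type]
        simp only [← hv, max_eq_right (hv' _).le, Finset.sum_const_zero, add_zero]

lemma sign_smul_colMinor_mul_of_mapsTo (p q : Fin n → Prop) [DecidablePred p] [DecidablePred q]
    (f g : Fin n → Fin N) (σ : Equiv.Perm ({i // p i} ⊕ {i // q i}))
    (hσ : Set.MapsTo σ (Set.range Sum.inl) (Set.range Sum.inl)) :
    Equiv.Perm.sign σ •
      (colMinor (overwrite p f fun i =>
          Sum.elim (fun i : {i // p i} => f i) (fun i : {i // q i} => g i) (σ (.inl i))) *
        colMinor (overwrite q g fun i =>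
          Sum.elim (fun i : {i // p i} => f i) (fun i : {i // q i} => g i) (σ (.inr i)))) =
      colMinor f * colMinor g := by
  obtain ⟨⟨σ₁, σ₂⟩, rfl⟩ := Equiv.Perm.mem_sumCongrHom_range_of_perm_mapsTo_inl hσ
  simp only [Equiv.Perm.sumCongrHom_apply, Equiv.Perm.sumCongr_apply, Sum.map_inl, Sum.map_inr,
    Sum.elim_inl, Sum.elim_inr, overwrite_perm, colMinor_comp_perm, Equiv.Perm.sign_ofSubtype,
    Equiv.Perm.sign_sumCongr]
  rcases Int.units_eq_one_or (Equiv.Perm.sign σ₁) with h₁ | h₁ <;>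
  rcases Int.units_eq_one_or (Equiv.Perm.sign σ₂) with h₂ | h₂ <;>
  simp [h₁, h₂]

theorem colMinor_mul_colMinor_mem_span (f g : Fin n → Fin N) :
    colMinor f * colMinor g ∈
      Submodule.span ℂ ((fun P => colMinor P.1 * colMinor P.2) '' stdPairs n N) := by
  set W := Submodule.span ℂ
    ((fun P : (Fin n → Fin N) × (Fin n → Fin N) => colMinor P.1 * colMinor P.2) '' stdPairs n N)
  have hsign (h : Fin n → Fin N) (σ : Equiv.Perm (Fin n)) :
      colMinor h = colMinor (h ∘ σ) ∨ colMinor h = -colMinor (h ∘ σ) := by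
    rw [colMinor_comp_perm]
    rcases Int.units_eq_one_or (Equiv.Perm.sign σ) with e | e <;> simp [e]
  have hsort (h : Fin n → Fin N) (hi : Function.Injective h) : StrictMono (h ∘ Tuple.sort h) :=
    (Tuple.monotone_sort h).strictMono_of_injective (hi.comp (Tuple.sort h).injective)
  induction hs : ∑ i, (f i : ℕ) using Nat.strong_induction_on generalizing f g with
  | _ s ih =>
    subst hs
    by_cases hf : Function.Injective f
    swap
    · rw [colMinor_eq_zero hf, zero_mul]
      exact W.zero_mem
    by_cases hg : Function.Injective g
    swap
    · rw [colMinor_eq_zero hg, mul_zero]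
      exact W.zero_mem
    suffices h : colMinor (f ∘ Tuple.sort f) * colMinor (g ∘ Tuple.sort g) ∈ W by
      rcases hsign f (Tuple.sort f) with e₁ | e₁ <;> rcases hsign g (Tuple.sort g) with e₂ | e₂ <;>
      rw [e₁, e₂] <;> simpa using h
    have hsum : ∑ i, ((f ∘ Tuple.sort f) i : ℕ) = ∑ i, (f i : ℕ) :=
      Equiv.sum_comp (Tuple.sort f) fun i => (f i : ℕ)
    rw [← hsum] at ih
    replace hf := hsort f hf
    replace hg := hsort g hg
    generalize f ∘ Tuple.sort f = f at hf ih
    generalize g ∘ Tuple.sort g = g at hg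
    by_cases hle : f ≤ g
    · exact Submodule.subset_span ⟨(f, g), ⟨hf, hg, hle⟩, rfl⟩
    obtain ⟨a, ha⟩ : ∃ a, g a < f a := by simpa [Pi.le_def] using hle
    let u : {i // a ≤ i} ⊕ {i // i ≤ a} → Fin N := Sum.elim (fun i => f i) (fun i => g i)
    have hrel := sum_sign_smul_colMinor_mul (a ≤ ·) (· ≤ a)
      (by
        rw [Fintype.card_sum, Fintype.card_subtype, Fintype.card_subtype,
          Finset.filter_le_eq_Ici, Finset.filter_ge_eq_Iic, Fin.card_Ici, Fin.card_Iic]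
        omega) f g u
    classical
    let B := Finset.univ.filter fun σ : Equiv.Perm ({i // a ≤ i} ⊕ {i // i ≤ a}) =>
      Set.MapsTo σ (Set.range Sum.inl) (Set.range Sum.inl)
    have hB : (B.card : ℂ) ≠ 0 := Nat.cast_ne_zero.2
      (Finset.card_ne_zero_of_mem (Finset.mem_filter.2 ⟨Finset.mem_univ 1, Set.mapsTo_id _⟩))
    rw [← Finset.sum_filter_add_sum_filter_not _
      (fun σ : Equiv.Perm ({i // a ≤ i} ⊕ {i // i ≤ a}) =>
        Set.MapsTo σ (Set.range Sum.inl) (Set.range Sum.inl)),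
      Finset.sum_congr rfl fun σ hσ => sign_smul_colMinor_mul_of_mapsTo (a ≤ ·) (· ≤ a) f g σ
        (Finset.mem_filter.1 hσ).2, Finset.sum_const, add_eq_zero_iff_eq_neg,
      ← Nat.cast_smul_eq_nsmul ℂ] at hrel
    refine (W.smul_mem_iff hB).1 (hrel ▸ W.neg_mem ?_)
    refine W.sum_mem fun σ hσ => ?_
    have hmem := ih _ (sum_overwrite_lt (a ≤ ·) (· ≤ a) f u (fun _ => rfl) (f a)
      (fun i => hf.monotone i.2) (fun i => (hg.monotone i.2).trans_lt ha) σ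
      (Finset.mem_filter.1 hσ).2) _ (overwrite (· ≤ a) g fun i => u (σ (.inr i))) rfl
    rcases Int.units_eq_one_or (Equiv.Perm.sign σ) with e | e <;> rw [e]
    · simpa using hmem
    · simpa using hmem

end Straightening

section Standard

open MvPolynomial

variable {n N : ℕ}

lemma triangular_stdPairs {P Q : (Fin n → Fin N) × (Fin n → Fin N)} (hP : P ∈ stdPairs n N)
    (hQ : Q ∈ stdPairs n N)
    (h : coeff (rowMon P.1 + rowMon P.2) (colMinor Q.1 * colMinor Q.2) ≠ 0) :
    rowSum Q ≤ rowSum P ∧ (rowSum Q = rowSum P → Q = P) := by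
  obtain ⟨σ, τ, e⟩ := exists_of_coeff_ne_zero h
  obtain ⟨h1, h2⟩ := rowSum_le_and_eq hQ.1 hQ.2.1 e
  refine ⟨h1, fun he => ?_⟩
  obtain ⟨rfl, rfl⟩ := h2 he
  exact (eq_of_rowMon_add_eq hP.2.2 hQ.2.2 e).symm

lemma exists_coeff_stdPairs_sum_eq {c : ((Fin n → Fin N) × (Fin n → Fin N)) →₀ ℂ}
    (hc : (c.support : Set _) ⊆ stdPairs n N) (S : (Fin n → Fin N) × (Fin n → Fin N) → Prop)
    (hS : ∀ P ∈ c.support, ∀ Q ∈ c.support, S P →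
      coeff (rowMon P.1 + rowMon P.2) (colMinor Q.1 * colMinor Q.2) ≠ 0 → S Q)
    {Q₀ : (Fin n → Fin N) × (Fin n → Fin N)} (hQ₀ : Q₀ ∈ c.support) (hSQ₀ : S Q₀) :
    ∃ P ∈ c.support, S P ∧ rowSum P ≤ rowSum Q₀ ∧
      coeff (rowMon P.1 + rowMon P.2) (c.sum fun Q a => a • (colMinor Q.1 * colMinor Q.2)) ≠ 0 := by
  obtain ⟨P, hP, hSP, hle, he⟩ := exists_coeff_sum_eq c
    (fun Q => colMinor Q.1 * colMinor Q.2) (fun P => rowMon P.1 + rowMon P.2) rowSum S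
    (fun P hP => coeff_rowMon_add (hc hP).1 (hc hP).2.1)
    (fun P hP Q hQ hSP h => ⟨hS P hP Q hQ hSP h, triangular_stdPairs (hc hP) (hc hQ) h⟩) hQ₀ hSQ₀
  exact ⟨P, hP, hSP, hle, he ▸ Finsupp.mem_support_iff.1 hP⟩

/-- Standard monomials of degree two are linearly independent. -/
lemma stdPairs_expansion_unique {c c' : ((Fin n → Fin N) × (Fin n → Fin N)) →₀ ℂ}
    (hc : (c.support : Set _) ⊆ stdPairs n N) (hc' : (c'.support : Set _) ⊆ stdPairs n N)
    (h : (c.sum fun P a => a • (colMinor P.1 * colMinor P.2)) =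
      c'.sum fun P a => a • (colMinor P.1 * colMinor P.2)) : c = c' := by
  classical
  rw [← sub_eq_zero]
  by_contra hne
  obtain ⟨Q₀, hQ₀⟩ := Finsupp.support_nonempty_iff.2 hne
  have hsub : ((c - c').support : Set _) ⊆ stdPairs n N := fun P hP => by
    rcases Finset.mem_union.1 (Finsupp.support_sub hP) with h | h
    exacts [hc h, hc' h]
  obtain ⟨P, -, -, -, hP⟩ := exists_coeff_stdPairs_sum_eq hsub (fun _ => True)
    (fun _ _ _ _ _ _ => trivial) hQ₀ trivial
  rw [Finsupp.sum_sub_index fun _ _ _ => sub_smul _ _ _, h, sub_self] at hP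
  exact hP (coeff_zero _)

variable {f g : Fin n → Fin N} {c : ((Fin n → Fin N) × (Fin n → Fin N)) →₀ ℂ}

lemma fst_le_of_expansion (hf : StrictMono f) (hg : StrictMono g)
    (hc : (c.support : Set _) ⊆ stdPairs n N)
    (h : colMinor f * colMinor g = c.sum fun P a => a • (colMinor P.1 * colMinor P.2))
    {P : (Fin n → Fin N) × (Fin n → Fin N)} (hP : P ∈ c.support) : P.1 ≤ f ∧ P.1 ≤ g := by
  have ht := (hc hP).1.monotone
  obtain ⟨Q, hQ, hPQ, -, hne⟩ := exists_coeff_stdPairs_sum_eq hc (fun Q => P.1 ≤ Q.1)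
    (fun Q hQ Q' hQ' hPQ hne => by
      obtain ⟨σ, τ, e⟩ := exists_of_coeff_ne_zero hne
      exact (le_of_rowMon_add_eq ht (hc hQ').1.monotone (hc hQ').2.1.monotone hPQ
        (hPQ.trans (hc hQ).2.2) e).1) hP le_rfl
  obtain ⟨σ, τ, e⟩ := exists_of_coeff_ne_zero (h ▸ hne)
  exact le_of_rowMon_add_eq ht hf.monotone hg.monotone hPQ (hPQ.trans (hc hQ).2.2) e

lemma le_snd_of_expansion (hf : StrictMono f) (hg : StrictMono g)
    (hc : (c.support : Set _) ⊆ stdPairs n N)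
    (h : colMinor f * colMinor g = c.sum fun P a => a • (colMinor P.1 * colMinor P.2))
    {P : (Fin n → Fin N) × (Fin n → Fin N)} (hP : P ∈ c.support) : f ≤ P.2 ∧ g ≤ P.2 := by
  have ht := (hc hP).2.1.monotone
  obtain ⟨Q, hQ, hPQ, -, hne⟩ := exists_coeff_stdPairs_sum_eq hc (fun Q => Q.2 ≤ P.2)
    (fun Q hQ Q' hQ' hPQ hne => by
      obtain ⟨σ, τ, e⟩ := exists_of_coeff_ne_zero hne
      exact (ge_of_rowMon_add_eq ht (hc hQ').1.monotone (hc hQ').2.1.monotone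
        ((hc hQ).2.2.trans hPQ) hPQ e).2) hP le_rfl
  obtain ⟨σ, τ, e⟩ := exists_of_coeff_ne_zero (h ▸ hne)
  exact ge_of_rowMon_add_eq ht hf.monotone hg.monotone ((hc hQ).2.2.trans hPQ) hPQ e

lemma rowSum_le_of_expansion (hf : StrictMono f) (hg : StrictMono g)
    (hc : (c.support : Set _) ⊆ stdPairs n N)
    (h : colMinor f * colMinor g = c.sum fun P a => a • (colMinor P.1 * colMinor P.2))
    {P : (Fin n → Fin N) × (Fin n → Fin N)} (hP : P ∈ c.support) :
    rowSum (f, g) ≤ rowSum P := by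
  obtain ⟨Q, hQ, -, hle, hne⟩ := exists_coeff_stdPairs_sum_eq hc (fun _ => True)
    (fun _ _ _ _ _ _ => trivial) hP trivial
  obtain ⟨σ, τ, e⟩ := exists_of_coeff_ne_zero (h ▸ hne)
  exact (rowSum_le_and_eq hf hg e).1.trans hle

lemma inf_sup_mem_stdPairs (hf : StrictMono f) (hg : StrictMono g) :
    (f ⊓ g, f ⊔ g) ∈ stdPairs n N :=
  ⟨fun _ _ h => min_lt_min (hf h) (hg h), fun _ _ h => max_lt_max (hf h) (hg h), inf_le_sup⟩

lemma coeff_inf_sup_of_expansion (hf : StrictMono f) (hg : StrictMono g)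
    (hc : (c.support : Set _) ⊆ stdPairs n N)
    (h : colMinor f * colMinor g = c.sum fun P a => a • (colMinor P.1 * colMinor P.2)) :
    c (f ⊓ g, f ⊔ g) = 1 := by
  have hmem := inf_sup_mem_stdPairs hf hg
  have hsum : rowSum (f ⊓ g, f ⊔ g) = rowSum (f, g) :=
    funext fun i => rowMon_add_eq_sum (rowMon_inf_add_sup f g) i
  have h1 := congrArg (coeff (rowMon (f ⊓ g) + rowMon (f ⊔ g))) h
  rw [rowMon_inf_add_sup, coeff_rowMon_add hf hg, ← rowMon_inf_add_sup, Finsupp.sum, coeff_sum,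
    Finset.sum_eq_single (f ⊓ g, f ⊔ g), coeff_smul, coeff_rowMon_add hmem.1 hmem.2.1,
    smul_eq_mul, mul_one] at h1
  · exact h1.symm
  · intro P hP hne
    rw [coeff_smul, smul_eq_zero]
    right
    by_contra hcoeff
    obtain ⟨hle, heq⟩ := triangular_stdPairs hmem (hc hP) hcoeff
    exact hne (heq (hle.antisymm (hsum ▸ rowSum_le_of_expansion hf hg hc h hP)))
  · intro hP
    rw [Finsupp.notMem_support_iff.1 hP, zero_smul, coeff_zero]

end Standard

section Lists

variable {n N : ℕ}

/-- The list of (1-based) columns of a column sequence. -/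
def colList (f : Fin n → Fin N) : List ℕ :=
  List.ofFn fun i => (f i : ℕ) + 1

lemma colList_getD (f : Fin n → Fin N) (i : Fin n) : (colList f).getD i 0 = f i + 1 := by
  simp [colList]

lemma colList_injective : Function.Injective (colList : (Fin n → Fin N) → List ℕ) :=
  fun f g h => funext fun i => Fin.ext <| by
    have := congrArg (fun l => l.getD i 0) h
    simpa only [colList_getD, add_left_inj] using this

lemma memPl_colList_iff (f : Fin n → Fin N) : memPl n N (colList f) ↔ StrictMono f := by
  have h : ∀ x ∈ colList f, 1 ≤ x ∧ x ≤ N := fun x hx => by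
    obtain ⟨i, rfl⟩ := (List.mem_ofFn' _ _).1 hx
    exact ⟨Nat.le_add_left 1 _, (f i).2⟩
  have hlen : (colList f).length = n := List.length_ofFn
  have hchain : (colList f).IsChain (· < ·) ↔ StrictMono f := by
    rw [List.isChain_iff_pairwise, colList, List.pairwise_ofFn]
    simp only [add_lt_add_iff_right, Fin.val_fin_lt]
    exact ⟨fun h i j hij => h hij, fun h i j hij => h hij⟩
  exact ⟨fun hK => hchain.1 hK.2.1, fun hf => ⟨hlen, hchain.2 hf, h⟩⟩

lemma memPl.exists_colList {K : List ℕ} (hK : memPl n N K) : ∃ f : Fin n → Fin N, colList f = K := by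
  obtain ⟨rfl, -, h⟩ := hK
  refine ⟨fun i => ⟨K[i] - 1, ?_⟩, ?_⟩
  · have := h K[i] (List.getElem_mem _)
    omega
  · refine List.ext_getElem (by simp [colList]) fun i h1 h2 => ?_
    have := h K[i] (List.getElem_mem _)
    simp [colList]
    omega

lemma zipWith_min_colList (f g : Fin n → Fin N) :
    List.zipWith min (colList f) (colList g) = colList (f ⊓ g) := by
  refine List.ext_getElem (by simp [colList]) fun i h1 h2 => ?_
  simp only [colList, List.getElem_zipWith, List.getElem_ofFn, Pi.inf_apply, Fin.coe_min]
  omega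

lemma zipWith_max_colList (f g : Fin n → Fin N) :
    List.zipWith max (colList f) (colList g) = colList (f ⊔ g) := by
  refine List.ext_getElem (by simp [colList]) fun i h1 h2 => ?_
  simp only [colList, List.getElem_zipWith, List.getElem_ofFn, Pi.sup_apply, Fin.coe_max]
  omega

lemma pld_colList {m : ℕ} (f : Fin n → Fin (m + n)) : pld n m (colList f) = colMinor f := by
  have hlen : ((List.range n).map (· + 1)).length = n := by simp
  rw [pld, dmin, colMinor, ← Matrix.det_submatrix_equiv_self (finCongr hlen)]
  congr 1
  refine Matrix.ext fun i j => ?_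
  have hi : (i : ℕ) < n := i.2.trans_eq hlen
  have hj : (colList f).getD j 0 = f (finCongr hlen j) + 1 := colList_getD f (finCongr hlen j)
  simp only [Matrix.of_apply, Matrix.submatrix_apply, hj]
  simp [hi]
  rfl

/-- The pair of lists of columns of a pair of column sequences. -/
def pairList (P : (Fin n → Fin N) × (Fin n → Fin N)) : List ℕ × List ℕ :=
  (colList P.1, colList P.2)

lemma pairList_injective :
    Function.Injective (pairList : (Fin n → Fin N) × (Fin n → Fin N) → List ℕ × List ℕ) :=
  fun _ _ h => Prod.ext (colList_injective (congrArg Prod.fst h))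
    (colList_injective (congrArg Prod.snd h))

lemma pairList_mem_iff (P : (Fin n → Fin N) × (Fin n → Fin N)) :
    (memPl n N (pairList P).1 ∧ memPl n N (pairList P).2 ∧
      ∀ r < n, (pairList P).1.getD r 0 ≤ (pairList P).2.getD r 0) ↔ P ∈ stdPairs n N := by
  have h : (∀ r < n, (pairList P).1.getD r 0 ≤ (pairList P).2.getD r 0) ↔ P.1 ≤ P.2 := by
    refine ⟨fun h i => ?_, fun h r hr => ?_⟩
    · have := h i i.2
      simp only [pairList, colList_getD] at this
      exact Fin.le_def.2 (by omega)
    · have := Fin.le_def.1 (h ⟨r, hr⟩)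
      have h1 := colList_getD P.1 ⟨r, hr⟩
      have h2 := colList_getD P.2 ⟨r, hr⟩
      simp only at h1 h2
      simp only [pairList, h1, h2]
      omega
  rw [h]
  exact and_congr (memPl_colList_iff _) (and_congr_left' (memPl_colList_iff _))

lemma expansion_mapDomain {m : ℕ} (l : ((Fin n → Fin (m + n)) × (Fin n → Fin (m + n))) →₀ ℂ) :
    ((l.mapDomain pairList).sum fun P a => a • (pld n m P.1 * pld n m P.2)) =
      l.sum fun P a => a • (colMinor P.1 * colMinor P.2) := by
  rw [Finsupp.sum_mapDomain_index_inj pairList_injective]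
  simp only [pairList, pld_colList]

lemma exists_mapDomain_of_standard {c : (List ℕ × List ℕ) →₀ ℂ}
    (hc : ∀ P ∈ c.support, memPl n N P.1 ∧ memPl n N P.2 ∧
      ∀ r < n, P.1.getD r 0 ≤ P.2.getD r 0) :
    ∃ l : ((Fin n → Fin N) × (Fin n → Fin N)) →₀ ℂ,
      (l.support : Set _) ⊆ stdPairs n N ∧ l.mapDomain pairList = c := by
  refine ⟨c.comapDomain pairList pairList_injective.injOn, fun P hP => ?_,
    Finsupp.mapDomain_comapDomain _ pairList_injective _ fun P hP => ?_⟩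
  · rw [Finset.mem_coe, Finsupp.comapDomain_support, Finset.mem_preimage] at hP
    exact (pairList_mem_iff P).1 (hc _ hP)
  · obtain ⟨h1, h2, -⟩ := hc P hP
    obtain ⟨f, hf⟩ := h1.exists_colList
    obtain ⟨g, hg⟩ := h2.exists_colList
    exact ⟨(f, g), Prod.ext hf hg⟩

end Lists

/-- straightening law for Plücker coordinates. For `K, K' ∈ Pl(n,m+n)`,
the product `δ_K δ_{K'}` has a unique expression as a linear combination of standard
monomials `δ_T δ_{T'}` with `T ⪯ T'`; in it `δ_{K∧K'} δ_{K∨K'}` has coefficient `1`,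
every term satisfies `T ⪯ K∧K' ⪯ K∨K' ⪯ T'`, and for every other term, at the first index
`a` where `T_a + T'_a` differs from `K_a + K'_a` one has `T_a + T'_a > K_a + K'_a`. -/
theorem pluecker_straightening (n m : ℕ) (hn : 0 < n) (hm : 0 < m) (K K' : List ℕ)
    (hK : memPl n (m + n) K) (hK' : memPl n (m + n) K') :
    ∃ c : (List ℕ × List ℕ) →₀ ℂ,
      ((∀ P ∈ c.support, memPl n (m + n) P.1 ∧ memPl n (m + n) P.2 ∧
          ∀ r < n, P.1.getD r 0 ≤ P.2.getD r 0) ∧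
        pld n m K * pld n m K' = c.sum fun P a => a • (pld n m P.1 * pld n m P.2)) ∧
      (∀ c' : (List ℕ × List ℕ) →₀ ℂ,
        ((∀ P ∈ c'.support, memPl n (m + n) P.1 ∧ memPl n (m + n) P.2 ∧
            ∀ r < n, P.1.getD r 0 ≤ P.2.getD r 0) ∧
          pld n m K * pld n m K' = c'.sum fun P a => a • (pld n m P.1 * pld n m P.2)) →
        c' = c) ∧
      c (List.zipWith min K K', List.zipWith max K K') = 1 ∧
      (∀ P ∈ c.support,
        ∀ r < n, P.1.getD r 0 ≤ (List.zipWith min K K').getD r 0 ∧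
          (List.zipWith max K K').getD r 0 ≤ P.2.getD r 0) ∧
      (∀ P ∈ c.support, P ≠ (List.zipWith min K K', List.zipWith max K K') →
        ∀ a < n, (∀ b < a, P.1.getD b 0 + P.2.getD b 0 = K.getD b 0 + K'.getD b 0) →
          P.1.getD a 0 + P.2.getD a 0 ≠ K.getD a 0 + K'.getD a 0 →
          K.getD a 0 + K'.getD a 0 < P.1.getD a 0 + P.2.getD a 0) := by
  obtain ⟨f, rfl⟩ := hK.exists_colList
  obtain ⟨g, rfl⟩ := hK'.exists_colList
  rw [memPl_colList_iff] at hK hK'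
  obtain ⟨l, hl, he⟩ := (Finsupp.mem_span_image_iff_linearCombination ℂ).1
    (colMinor_mul_colMinor_mem_span f g)
  rw [Finsupp.mem_supported] at hl
  rw [Finsupp.linearCombination_apply] at he
  have hsupp : ∀ P ∈ (l.mapDomain pairList).support, ∃ Q ∈ l.support, pairList Q = P :=
    fun P hP => Finset.mem_image.1 (Finsupp.mapDomain_support hP)
  rw [zipWith_min_colList, zipWith_max_colList, pld_colList, pld_colList]
  refine ⟨l.mapDomain pairList, ⟨fun P hP => ?_, ?_⟩, ?_, ?_, fun P hP r hr => ?_,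
    fun P hP _ a ha hlt hne => ?_⟩
  · obtain ⟨Q, hQ, rfl⟩ := hsupp P hP
    exact (pairList_mem_iff Q).2 (hl hQ)
  · rw [expansion_mapDomain, he]
  · rintro c' ⟨hc', he'⟩
    obtain ⟨l', hl', rfl⟩ := exists_mapDomain_of_standard hc'
    rw [expansion_mapDomain, ← he] at he'
    rw [stdPairs_expansion_unique hl hl' he']
  · exact (Finsupp.mapDomain_apply pairList_injective l (f ⊓ g, f ⊔ g)).trans
      (coeff_inf_sup_of_expansion hK hK' hl he.symm)
  · obtain ⟨Q, hQ, rfl⟩ := hsupp P hP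
    have h1 := fst_le_of_expansion hK hK' hl he.symm hQ
    have h2 := le_snd_of_expansion hK hK' hl he.symm hQ
    have h3 := Fin.le_def.1 (le_inf h1.1 h1.2 ⟨r, hr⟩)
    have h4 := Fin.le_def.1 (sup_le h2.1 h2.2 ⟨r, hr⟩)
    have hget (h : Fin n → Fin (m + n)) : (colList h).getD r 0 = h ⟨r, hr⟩ + 1 :=
      colList_getD h ⟨r, hr⟩
    simp only [pairList, hget]
    omega
  · obtain ⟨Q, hQ, rfl⟩ := hsupp P hP
    have hget (h : Fin n → Fin (m + n)) (b : Fin n) : (colList h).getD b 0 = h b + 1 :=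
      colList_getD h b
    lift a to Fin n using ha
    simp only [pairList, hget] at hne ⊢
    by_contra! hle
    refine (rowSum_le_of_expansion hK hK' hl he.symm hQ).not_gt ⟨a, fun b hb => ?_, ?_⟩
    · have := hlt b hb
      simp only [pairList, hget] at this
      change (Q.1 b : ℕ) + Q.2 b = f b + g b
      omega
    · change (Q.1 a : ℕ) + Q.2 a < f a + g a
      omega

end
end
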